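/- Let K be a field, σ a finite type of indeterminates, and fix an admissible monomial order ≼ on σ →₀ ℕ. For every set F ⊆ MvPolynomial σ K and every polynomial p ∈ MvPolynomial σ K, there exists a polynomial q such that p →*_F q and q is irreducible modulo F (i.e., there is no r with q →_F r). In other words, every polynomial has a normal form modulo F. -/

import Mathlib

open MvPolynomial Relation

/-- An admissible monomial order on `σ →₀ ℕ`: a linear order such that `0` is the
smallest element and which is compatible with addition. -/
structure AdmissibleOrder (σ : Type*) where
  le : (σ →₀ ℕ) → (σ →₀ ℕ) → Prop
  total : ∀ s t, le s t ∨ le t s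
  refl : ∀ t, le t t
  trans : ∀ s t u, le s t → le t u → le s u
  antisymm : ∀ s t, le s t → le t s → s = t
  zero_le : ∀ t, le 0 t
  add_right : ∀ s t u, le s t → le (s + u) (t + u)

namespace AdmissibleOrder

variable {σ : Type*} {K : Type*} [Field K]

/-- The strict part of an admissible order. -/
def lt (m : AdmissibleOrder σ) (s t : σ →₀ ℕ) : Prop := m.le s t ∧ s ≠ t

-- The leading monomial of a polynomial: the `m.le`-largest element of its support
-- (`0` for the zero polynomial).
open Classical in
noncomputable def lm (m : AdmissibleOrder σ) (p : MvPolynomial σ K) : σ →₀ ℕ :=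
  if h : ∃ v, v ∈ p.support ∧ ∀ u ∈ p.support, m.le u v then h.choose else 0

/-- The leading coefficient of a polynomial. -/
noncomputable def lc (m : AdmissibleOrder σ) (p : MvPolynomial σ K) : K :=
  coeff (m.lm p) p

/-- One-step polynomial reduction modulo a set `F`. -/
def Red (m : AdmissibleOrder σ) (F : Set (MvPolynomial σ K))
    (p q : MvPolynomial σ K) : Prop :=
  ∃ f ∈ F, f ≠ 0 ∧ ∃ t : σ →₀ ℕ,
    coeff (t + m.lm f) p ≠ 0 ∧
    q = p - (coeff (t + m.lm f) p / m.lc f) • (monomial t (1 : K)) * f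

/-- A set `G` is a Gröbner basis iff the reduction relation modulo `G` is confluent. -/
def IsGroebner (m : AdmissibleOrder σ) (G : Set (MvPolynomial σ K)) : Prop :=
  ∀ a b c : MvPolynomial σ K, ReflTransGen (m.Red G) a b → ReflTransGen (m.Red G) a c →
    ∃ d, ReflTransGen (m.Red G) b d ∧ ReflTransGen (m.Red G) c d

-- The S-polynomial of two polynomials.
open Classical in
noncomputable def spoly (m : AdmissibleOrder σ) (p q : MvPolynomial σ K) :
    MvPolynomial σ K :=
  if p = 0 ∨ q = 0 then 0 else
    (monomial (m.lm p ⊔ m.lm q - m.lm p) (1 / m.lc p)) * p -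
    (monomial (m.lm p ⊔ m.lm q - m.lm q) (1 / m.lc q)) * q

end AdmissibleOrder

namespace AdmissibleOrder

theorem exists_greatest {σ : Type*} (m : AdmissibleOrder σ) {s : Finset (σ →₀ ℕ)}
    (hs : s.Nonempty) : ∃ v ∈ s, ∀ u ∈ s, m.le u v := by
  induction hs using Finset.Nonempty.cons_induction with
  | singleton a => exact ⟨a, by simp, by simpa using m.refl a⟩
  | cons a s ha hs ih =>
    obtain ⟨v, hv, hmax⟩ := ih
    rcases m.total a v with h | h
    · exact ⟨v, by simp [hv], by simpa using ⟨h, hmax⟩⟩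
    · exact ⟨a, by simp, by simpa using ⟨m.refl a, fun u hu => m.trans _ _ _ (hmax u hu) h⟩⟩

theorem le_of_le {σ : Type*} (m : AdmissibleOrder σ) {s t : σ →₀ ℕ} (h : s ≤ t) : m.le s t := by
  simpa [tsub_add_cancel_of_le h] using m.add_right 0 (t - s) s (m.zero_le _)

theorem wellFounded_lt {σ : Type*} [Finite σ] (m : AdmissibleOrder σ) : WellFounded m.lt := by
  have : IsPreorder (σ →₀ ℕ) m.le := { refl := m.refl, trans := m.trans }
  have hwqo : WellQuasiOrdered m.le := fun f => by
    obtain ⟨i, j, hij, h⟩ := wellQuasiOrdered_le f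
    exact ⟨i, j, hij, m.le_of_le h⟩
  refine hwqo.wellFounded.mono fun s t h => ⟨h.1, fun h' => h.2 (m.antisymm _ _ h.1 h')⟩

section

variable {σ K : Type*} [Field K]

theorem lm_spec (m : AdmissibleOrder σ) {f : MvPolynomial σ K} (hf : f ≠ 0) :
    m.lm f ∈ f.support ∧ ∀ u ∈ f.support, m.le u (m.lm f) := by
  have h := m.exists_greatest (MvPolynomial.support_nonempty.mpr hf)
  unfold lm
  rw [dif_pos h]
  exact h.choose_spec

theorem lc_ne_zero (m : AdmissibleOrder σ) {f : MvPolynomial σ K} (hf : f ≠ 0) : m.lc f ≠ 0 :=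
  mem_support_iff.mp (m.lm_spec hf).1

theorem le_of_coeff_monomial_mul_ne_zero (m : AdmissibleOrder σ) {f : MvPolynomial σ K}
    {t v : σ →₀ ℕ} (h : coeff v (monomial t (1 : K) * f) ≠ 0) : m.le v (t + m.lm f) := by
  rw [coeff_monomial_mul'] at h
  obtain ⟨htv, hc⟩ := ite_ne_right_iff.mp h
  rw [one_mul] at hc
  have hf : f ≠ 0 := by
    rintro rfl
    exact hc (coeff_zero _)
  have := m.add_right _ _ t ((m.lm_spec hf).2 _ (mem_support_iff.mpr hc))
  rwa [tsub_add_cancel_of_le htv, add_comm] at this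

/-- A monomial is reducible modulo `F` if it is a multiple of the leading monomial of some nonzero
element of `F`. -/
def IsReducibleMonomial (m : AdmissibleOrder σ) (F : Set (MvPolynomial σ K)) (v : σ →₀ ℕ) : Prop :=
  ∃ f ∈ F, f ≠ 0 ∧ ∃ t, v = t + m.lm f

/-- Reducing at the largest reducible monomial `w` leaves only reducible monomials below `w`. -/
theorem irreducible_or_exists_red (m : AdmissibleOrder σ) (F : Set (MvPolynomial σ K))
    (p : MvPolynomial σ K) :
    (∀ r, ¬ m.Red F p r) ∨ ∃ w ∈ p.support, m.IsReducibleMonomial F w ∧ ∃ q, m.Red F p q ∧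
      ∀ v ∈ q.support, m.IsReducibleMonomial F v → m.lt v w := by
  classical
  by_cases hne : (p.support.filter (m.IsReducibleMonomial F)).Nonempty
  · right
    obtain ⟨w, hw, hmax⟩ := m.exists_greatest hne
    obtain ⟨hwp, hwF⟩ := Finset.mem_filter.mp hw
    obtain ⟨f, hf, hf0, t, rfl⟩ := id hwF
    refine ⟨_, hwp, hwF, _, ⟨f, hf, hf0, t, mem_support_iff.mp hwp, rfl⟩, fun v hv hvF => ?_⟩
    rw [mem_support_iff, smul_mul_assoc, coeff_sub, coeff_smul, smul_eq_mul] at hv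
    refine ⟨?_, ?_⟩
    · by_cases hc : coeff v (monomial t (1 : K) * f) = 0
      · rw [hc, mul_zero, sub_zero] at hv
        exact hmax v (Finset.mem_filter.mpr ⟨mem_support_iff.mpr hv, hvF⟩)
      · exact m.le_of_coeff_monomial_mul_ne_zero hc
    · rintro rfl
      rw [coeff_monomial_mul, one_mul] at hv
      exact hv (sub_eq_zero.mpr (div_mul_cancel₀ _ (m.lc_ne_zero hf0)).symm)
  · left
    rintro r ⟨f, hf, hf0, t, hc, -⟩
    exact hne ⟨_, Finset.mem_filter.mpr ⟨mem_support_iff.mpr hc, f, hf, hf0, t, rfl⟩⟩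

theorem exists_normal_form_of_lt [Finite σ] (m : AdmissibleOrder σ) (F : Set (MvPolynomial σ K))
    (u : σ →₀ ℕ) (p : MvPolynomial σ K)
    (hp : ∀ v ∈ p.support, m.IsReducibleMonomial F v → m.lt v u) :
    ∃ q, ReflTransGen (m.Red F) p q ∧ ∀ r, ¬ m.Red F q r := by
  induction u using m.wellFounded_lt.induction generalizing p with
  | _ u ih =>
    rcases m.irreducible_or_exists_red F p with h | ⟨w, hw, hwF, q, hpq, hq⟩
    · exact ⟨p, .refl, h⟩
    · obtain ⟨q', hqq', hq'⟩ := ih w (hp w hw hwF) q hq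
      exact ⟨q', .head hpq hqq', hq'⟩

end

end AdmissibleOrder

/-- Every polynomial has a normal form modulo any set `F`. -/
theorem exists_normal_form {σ K : Type*} [Fintype σ] [Field K] (m : AdmissibleOrder σ)
    (F : Set (MvPolynomial σ K)) (p : MvPolynomial σ K) :
    ∃ q, Relation.ReflTransGen (m.Red F) p q ∧ ∀ r, ¬ m.Red F q r := by
  rcases m.irreducible_or_exists_red F p with h | ⟨w, -, -, q, hpq, hq⟩
  · exact ⟨p, .refl, h⟩
  · obtain ⟨q', hqq', hq'⟩ := m.exists_normal_form_of_lt F w q hq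
    exact ⟨q', .head hpq hqq', hq'⟩
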